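/- Let G be a finite graph and C a configuration on G. If the sequence of pebbling moves Q = (q_1, q_2, ..., q_k) cover solves C, and Q' = (q_{i_1}, q_{i_2}, ..., q_{i_l}) is any collection of moves from Q (with 1 ≤ i_j ≤ k for all j, in any order) that can legally be executed starting from C, then the configuration C' obtained from C after executing the moves of Q' is cover solvable. -/

import Mathlib

variable {V : Type*} [DecidableEq V]

/-- Apply the pebbling move `q = (u, v)` to configuration `C`: remove two pebbles
from `u` and place one pebble on `v`. -/
def applyMove (C : V → ℕ) (q : V × V) : V → ℕ :=
  Function.update (Function.update C q.1 (C q.1 - 2)) q.2 (C q.2 + 1)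

/-- Apply a sequence of pebbling moves in order. -/
def applyMoves (C : V → ℕ) (Q : List (V × V)) : V → ℕ :=
  Q.foldl applyMove C

/-- A sequence of moves is legal from `C` if each move goes along an edge of `G`
and its source vertex holds at least two pebbles at the time the move is made. -/
def LegalSeq (G : SimpleGraph V) : (V → ℕ) → List (V × V) → Prop
  | _, [] => True
  | C, q :: Q => G.Adj q.1 q.2 ∧ 2 ≤ C q.1 ∧ LegalSeq G (applyMove C q) Q

/-- A sequence of moves `Q` cover solves `C` if it is legal from `C` and executing
it results in at least one pebble on every vertex. -/
def CoverSolves (G : SimpleGraph V) (C : V → ℕ) (Q : List (V × V)) : Prop :=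
  LegalSeq G C Q ∧ ∀ v, 1 ≤ applyMoves C Q v

/-- A configuration is cover solvable if some sequence of moves cover solves it. -/
def CoverSolvable (G : SimpleGraph V) (C : V → ℕ) : Prop :=
  ∃ Q, CoverSolves G C Q

theorem LegalSeq.adj {G : SimpleGraph V} {C : V → ℕ} {Q : List (V × V)}
    (h : LegalSeq G C Q) : ∀ q ∈ Q, G.Adj q.1 q.2 := by
  induction Q generalizing C with
  | nil => simp
  | cons q Q ih =>
    simp only [List.mem_cons, forall_eq_or_imp]
    exact ⟨h.1, ih h.2.2⟩

/-- Conservation of pebbles at each vertex under a single move. -/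
theorem applyMove_add_ite {C : V → ℕ} {q : V × V} (hne : q.1 ≠ q.2) (h2 : 2 ≤ C q.1) (v : V) :
    applyMove C q v + 2 * (if q.1 = v then 1 else 0) = C v + if q.2 = v then 1 else 0 := by
  unfold applyMove
  by_cases h : q.2 = v
  · subst h
    simp [hne]
  · by_cases h' : q.1 = v
    · subst h'
      simp [hne, hne.symm]
      omega
    · simp [h, h', Function.update_of_ne (Ne.symm h), Function.update_of_ne (Ne.symm h')]

/-- Conservation of pebbles at each vertex under a legal sequence of moves. -/
theorem LegalSeq.applyMoves_add_count {G : SimpleGraph V} {C : V → ℕ} {Q : List (V × V)}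
    (h : LegalSeq G C Q) (v : V) :
    applyMoves C Q v + 2 * (Q.map Prod.fst).count v = C v + (Q.map Prod.snd).count v := by
  induction Q generalizing C with
  | nil => simp [applyMoves]
  | cons q Q ih =>
    have hrest := ih h.2.2
    have hmove := applyMove_add_ite h.1.ne h.2.1 v
    simp only [applyMoves, List.foldl_cons, List.map_cons, List.count_cons, beq_iff_eq] at *
    omega

/-- If the moves of `R` would leave a pebble on every vertex, then some source vertex in `R`
already holds two pebbles: otherwise every vertex would receive at least twice as many moves
from `R` as it emits. -/
theorem exists_mem_two_le_of_count_le {C : V → ℕ} {R : List (V × V)} (hR : R ≠ [])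
    (h : ∀ v, 1 + 2 * (R.map Prod.fst).count v ≤ C v + (R.map Prod.snd).count v) :
    ∃ q ∈ R, 2 ≤ C q.1 := by
  by_contra! hstuck
  have hle (v : V) : 2 * (R.map Prod.fst).count v ≤ (R.map Prod.snd).count v := by
    by_cases hv : v ∈ R.map Prod.fst
    · obtain ⟨q, hq, rfl⟩ := List.mem_map.1 hv
      have := h q.1
      have := hstuck q hq
      omega
    · simp [List.count_eq_zero_of_not_mem hv]
  let s := (R.map Prod.fst).toFinset ∪ (R.map Prod.snd).toFinset
  have hfst : ∑ v ∈ s, (R.map Prod.fst).count v = R.length := by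
    simpa using Multiset.sum_count_eq_card (s := s) (m := ↑(R.map Prod.fst))
      fun v hv => Finset.mem_union_left _ (List.mem_toFinset.2 hv)
  have hsnd : ∑ v ∈ s, (R.map Prod.snd).count v = R.length := by
    simpa using Multiset.sum_count_eq_card (s := s) (m := ↑(R.map Prod.snd))
      fun v hv => Finset.mem_union_right _ (List.mem_toFinset.2 hv)
  have hsum := Finset.sum_le_sum fun v (_ : v ∈ s) => hle v
  rw [← Finset.mul_sum, hfst, hsnd] at hsum
  have := List.length_pos_iff.2 hR
  omega

/-- Moves along edges whose net effect leaves a pebble on every vertex can be put into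
a legal order. -/
theorem coverSolvable_of_count_le {G : SimpleGraph V} {C : V → ℕ} {R : List (V × V)}
    (hadj : ∀ q ∈ R, G.Adj q.1 q.2)
    (h : ∀ v, 1 + 2 * (R.map Prod.fst).count v ≤ C v + (R.map Prod.snd).count v) :
    CoverSolvable G C := by
  induction hn : R.length generalizing C R with
  | zero =>
    obtain rfl := List.length_eq_zero_iff.1 hn
    exact ⟨[], trivial, by simpa [applyMoves] using h⟩
  | succ n ih =>
    obtain ⟨q, hq, h2⟩ := exists_mem_two_le_of_count_le (by rintro rfl; simp at hn) h
    have hperm := List.perm_cons_erase hq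
    obtain ⟨S, hS, hcover⟩ := ih (C := applyMove C q) (R := R.erase q)
      (fun p hp => hadj p (List.mem_of_mem_erase hp))
      (fun v => by
        have hv := h v
        have hmove := applyMove_add_ite (hadj q hq).ne h2 v
        rw [(hperm.map Prod.fst).count_eq, (hperm.map Prod.snd).count_eq] at hv
        simp only [List.map_cons, List.count_cons, beq_iff_eq] at hv
        omega)
      (by rw [List.length_erase_of_mem hq]; omega)
    exact ⟨q :: S, ⟨hadj q hq, h2, hS⟩, hcover⟩

/-- If the sequence of pebbling moves `Q` cover solves `C`, and `Q'` is any
collection of moves from `Q` (a sub-multiset, in any order) that can legally be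
executed starting from `C`, then the configuration obtained from `C` after
executing the moves of `Q'` is cover solvable. -/
theorem coverSolvable_after_partial_moves (G : SimpleGraph V) (C : V → ℕ)
    (Q Q' : List (V × V)) (hQ : CoverSolves G C Q) (hsub : List.Subperm Q' Q)
    (hleg : LegalSeq G C Q') :
    CoverSolvable G (applyMoves C Q') := by
  obtain ⟨S, hSQ', hSQ⟩ := hsub
  obtain ⟨R, hSR⟩ := hSQ.exists_perm_append
  have hperm : Q.Perm (Q' ++ R) := hSR.trans (hSQ'.append_right R)
  refine coverSolvable_of_count_le (R := R)
    (fun q hq => hQ.1.adj q (hperm.mem_iff.2 (List.mem_append_right _ hq))) fun v => ?_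
  have hv := hQ.1.applyMoves_add_count v
  have hv' := hleg.applyMoves_add_count v
  have hcover := hQ.2 v
  rw [(hperm.map Prod.fst).count_eq, (hperm.map Prod.snd).count_eq] at hv
  simp only [List.map_append, List.count_append] at hv
  omega
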